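/- For any undirected weighted graph G and any set P of vertex pairs with |P| = O(n^{1/3}), there exists a subgraph G' of G with O(n) edges such that d_{G'}(u,v) = d_G(u,v) for all (u,v) ∈ P (a pairwise distance preserver of linear size). -/

import Mathlib

open scoped ENNReal Classical

variable {V : Type*}

/-- The total weight of a walk: the sum of the weights of its (directed) edges. -/
noncomputable def walkWeight (w : V → V → ℝ≥0∞) {G : SimpleGraph V} {u v : V}
    (p : G.Walk u v) : ℝ≥0∞ :=
  (p.darts.map (fun d => w d.toProd.1 d.toProd.2)).sum

/-- Weighted shortest-path distance: the infimum of walk weights (`⊤` if unreachable). -/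
noncomputable def wdist (G : SimpleGraph V) (w : V → V → ℝ≥0∞) (u v : V) : ℝ≥0∞ :=
  ⨅ p : G.Walk u v, walkWeight w p


theorem ww_nil (w : V → V → ℝ≥0∞) {G : SimpleGraph V} (u : V) :
    walkWeight w (SimpleGraph.Walk.nil : G.Walk u u) = 0 := by simp [walkWeight]

theorem ww_cons (w : V → V → ℝ≥0∞) {G : SimpleGraph V} {u v x : V} (h : G.Adj u v)
    (p : G.Walk v x) : walkWeight w (SimpleGraph.Walk.cons h p) = w u v + walkWeight w p := by
  simp [walkWeight]

theorem ww_append (w : V → V → ℝ≥0∞) {G : SimpleGraph V} {u v x : V} (p : G.Walk u v)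
    (q : G.Walk v x) : walkWeight w (p.append q) = walkWeight w p + walkWeight w q := by
  simp [walkWeight]

theorem ww_reverse (w : V → V → ℝ≥0∞) (hw : ∀ u v, w u v = w v u) {G : SimpleGraph V} {u v : V}
    (p : G.Walk u v) : walkWeight w p.reverse = walkWeight w p := by
  induction p with
  | nil => simp
  | cons h p ih =>
    rw [SimpleGraph.Walk.reverse_cons, ww_append, ww_cons, ww_cons, ww_nil, ih, hw, add_zero,
      add_comm]

theorem ww_ne_top (w : V → V → ℝ≥0∞) {G : SimpleGraph V} (hf : ∀ u v, G.Adj u v → w u v ≠ ⊤)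
    {u v : V} (p : G.Walk u v) : walkWeight w p ≠ ⊤ := by
  induction p with
  | nil => simp [ww_nil]
  | cons h p ih =>
    rw [ww_cons]
    exact ENNReal.add_ne_top.2 ⟨hf _ _ h, ih⟩

theorem wdist_le_ww (w : V → V → ℝ≥0∞) {G : SimpleGraph V} {u v : V} (p : G.Walk u v) :
    wdist G w u v ≤ walkWeight w p := iInf_le _ p

theorem wdist_comm' (w : V → V → ℝ≥0∞) (hw : ∀ u v, w u v = w v u) (G : SimpleGraph V) (u v : V) :
    wdist G w u v = wdist G w v u := by
  apply le_antisymm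
  · refine le_iInf fun p => ?_
    rw [← ww_reverse w hw p]; exact wdist_le_ww w _
  · refine le_iInf fun p => ?_
    rw [← ww_reverse w hw p]; exact wdist_le_ww w _

/-- transfer of walks, tracking weight and membership of darts in a third graph -/
theorem exists_transfer (w : V → V → ℝ≥0∞) {G H : SimpleGraph V} {u v : V} (p : G.Walk u v)
    (h : ∀ d ∈ p.darts, H.Adj d.fst d.snd) :
    ∃ p' : H.Walk u v, walkWeight w p' = walkWeight w p := by
  induction p with
  | nil => exact ⟨.nil, by simp [ww_nil]⟩
  | cons h' p ih =>
    obtain ⟨p', hp'⟩ := ih (fun d hd => h d (by simp [hd]))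
    have h1 := h ⟨(_, _), h'⟩ (by simp)
    exact ⟨.cons h1 p', by rw [ww_cons, ww_cons, hp']⟩

theorem ww_mapLe (w : V → V → ℝ≥0∞) {G H : SimpleGraph V} (hle : H ≤ G) {u v : V}
    (p : H.Walk u v) : walkWeight w (p.mapLe hle) = walkWeight w p := by
  induction p with
  | nil => simp [walkWeight]
  | cons h p ih =>
    have : (SimpleGraph.Walk.cons h p).mapLe hle
      = SimpleGraph.Walk.cons (hle h) (p.mapLe hle) := rfl
    rw [this, ww_cons, ww_cons, ih]

theorem wdist_mono (w : V → V → ℝ≥0∞) {G H : SimpleGraph V} (hle : H ≤ G) (u v : V) :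
    wdist G w u v ≤ wdist H w u v := by
  refine le_iInf fun p => ?_
  rw [← ww_mapLe w hle p]; exact wdist_le_ww w _

/-- number of darts of a walk not in `H` -/
noncomputable def newCount (H : SimpleGraph V) {G : SimpleGraph V} {u v : V} (p : G.Walk u v) : ℕ :=
  p.darts.countP (fun d => ¬ H.Adj d.fst d.snd)

theorem nc_append (H : SimpleGraph V) {G : SimpleGraph V} {u v x : V} (p : G.Walk u v)
    (q : G.Walk v x) : newCount H (p.append q) = newCount H p + newCount H q := by
  simp [newCount]

theorem nc_mapLe {G H : SimpleGraph V} (hle : H ≤ G) {u v : V}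
    (p : H.Walk u v) : newCount H (p.mapLe hle) = 0 := by
  induction p with
  | nil => simp [newCount]
  | cons h p ih =>
    have : (SimpleGraph.Walk.cons h p).mapLe hle
      = SimpleGraph.Walk.cons (hle h) (p.mapLe hle) := rfl
    rw [this]
    simp only [newCount, SimpleGraph.Walk.darts_cons] at *
    rw [List.countP_cons_of_neg, ih]
    simpa using h

theorem bypass_sub {G : SimpleGraph V} {u v : V} (p : G.Walk u v) :
    p.bypass.darts.Sublist p.darts := by
  induction p with
  | nil => simp [SimpleGraph.Walk.bypass]
  | cons h p ih =>
    simp only [SimpleGraph.Walk.bypass]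
    split_ifs with hs
    · refine List.Sublist.trans ?_ ((ih.trans (List.sublist_cons_self _ _)))
      conv_rhs => rw [← SimpleGraph.Walk.take_spec _ hs, SimpleGraph.Walk.darts_append]
      exact List.sublist_append_right _ _
    · simpa using ih

theorem ww_bypass (w : V → V → ℝ≥0∞) {G : SimpleGraph V} {u v : V} (p : G.Walk u v) :
    walkWeight w p.bypass ≤ walkWeight w p :=
  List.Sublist.sum_le_sum ((bypass_sub p).map _) (by simp)

theorem nc_bypass (H : SimpleGraph V) {G : SimpleGraph V} {u v : V} (p : G.Walk u v) :
    newCount H p.bypass ≤ newCount H p := List.Sublist.countP_le (bypass_sub p)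

theorem wdist_attained [Fintype V] (w : V → V → ℝ≥0∞) {G : SimpleGraph V} {u v : V}
    (h : G.Reachable u v) : ∃ p : G.Walk u v, walkWeight w p = wdist G w u v := by
  haveI : Nonempty (G.Path u v) := ⟨⟨h.some.bypass, h.some.bypass_isPath⟩⟩
  obtain ⟨p, hp⟩ := Finite.exists_min (fun p : G.Path u v => walkWeight w p.1)
  refine ⟨p.1, le_antisymm ?_ (wdist_le_ww w _)⟩
  refine le_iInf fun q => ?_
  exact (hp ⟨q.bypass, q.bypass_isPath⟩).trans (ww_bypass w q)

theorem dart_split {G : SimpleGraph V} {u v : V} (p : G.Walk u v) (d : G.Dart) (hd : d ∈ p.darts) :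
    ∃ (A : G.Walk u d.fst) (B : G.Walk d.snd v), p = A.append (.cons d.adj B) := by
  induction p with
  | nil => simp at hd
  | cons h p ih =>
    rw [SimpleGraph.Walk.darts_cons, List.mem_cons] at hd
    rcases hd with rfl | hd
    · exact ⟨.nil, p, rfl⟩
    · obtain ⟨A, B, rfl⟩ := ih hd
      exact ⟨.cons h A, B, rfl⟩

theorem mid_shortest (w : V → V → ℝ≥0∞) {G : SimpleGraph V} (hf : ∀ u v, G.Adj u v → w u v ≠ ⊤)
    {s t y z : V} (A : G.Walk s y) (B : G.Walk y z) (C : G.Walk z t)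
    (h : walkWeight w (A.append (B.append C)) = wdist G w s t) :
    walkWeight w B = wdist G w y z := by
  refine le_antisymm (le_iInf fun B' => ?_) (wdist_le_ww w _)
  have h2 := wdist_le_ww w (A.append (B'.append C))
  rw [← h] at h2
  simp only [ww_append] at h2
  have h3 := (ENNReal.add_le_add_iff_left (ww_ne_top w hf A)).1 h2
  exact (ENNReal.add_le_add_iff_right (ww_ne_top w hf C)).1 h3

/-- rerouting through an old shortest path -/
theorem reroute [Fintype V] (w : V → V → ℝ≥0∞) {G H : SimpleGraph V} (hle : H ≤ G)
    (hf : ∀ u v, G.Adj u v → w u v ≠ ⊤)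
    {s t y z : V} (A : G.Walk s y) (B : G.Walk y z) (C : G.Walk z t)
    (h : walkWeight w (A.append (B.append C)) = wdist G w s t)
    (hmin : ∀ q : G.Walk s t, walkWeight w q = wdist G w s t →
      newCount H (A.append (B.append C)) ≤ newCount H q)
    (hyz : wdist H w y z = wdist G w y z) : newCount H B = 0 := by
  have hB := mid_shortest w hf A B C h
  have hr : H.Reachable y z := by
    by_contra hn
    have : wdist H w y z = ⊤ := by
      refine top_le_iff.1 (le_iInf fun p => (hn ⟨p⟩).elim)
    rw [this] at hyz
    exact ww_ne_top w hf B (hB.trans hyz.symm)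
  obtain ⟨B', hB'⟩ := wdist_attained w hr
  have h2 := hmin (A.append ((B'.mapLe hle).append C)) (by
    rw [← h]; simp only [ww_append, ww_mapLe, hB', hyz, hB])
  simp only [nc_append, nc_mapLe] at h2
  omega

theorem order_new [Fintype V] (w : V → V → ℝ≥0∞) {G H : SimpleGraph V} (hle : H ≤ G)
    (hf : ∀ u v, G.Adj u v → w u v ≠ ⊤) (hw : ∀ u v, w u v = w v u)
    {s t : V} (q : G.Walk s t)
    (h : walkWeight w q = wdist G w s t)
    (hmin : ∀ q' : G.Walk s t, walkWeight w q' = wdist G w s t → newCount H q ≤ newCount H q')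
    (d e : G.Dart) (hd : d ∈ q.darts) (he : e ∈ q.darts)
    (hdn : ¬ H.Adj d.fst d.snd) (hen : ¬ H.Adj e.fst e.snd)
    (hde : wdist H w d.snd e.snd = wdist G w d.snd e.snd) : d = e := by
  by_contra hne
  obtain ⟨A, B, rfl⟩ := dart_split q d hd
  simp only [SimpleGraph.Walk.darts_append, SimpleGraph.Walk.darts_cons, List.mem_append,
    List.mem_cons] at he
  rcases he with he | he | he
  · obtain ⟨A1, A2, rfl⟩ := dart_split A e he
    have key : (A1.append (SimpleGraph.Walk.cons e.adj A2)).append (.cons d.adj B)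
      = (A1.append (SimpleGraph.Walk.cons e.adj .nil)).append
        ((A2.append (SimpleGraph.Walk.cons d.adj .nil)).append B) := by
      simp [← SimpleGraph.Walk.append_assoc]
    rw [key] at h hmin
    have := reroute w hle hf _ _ _ h hmin (by
      rw [wdist_comm' w hw H, wdist_comm' w hw G]; exact hde)
    simp [newCount, hdn] at this
  · exact hne he.symm
  · obtain ⟨B1, B2, rfl⟩ := dart_split B e he
    have key : A.append (SimpleGraph.Walk.cons d.adj (B1.append (.cons e.adj B2)))
      = (A.append (SimpleGraph.Walk.cons d.adj .nil)).append
        ((B1.append (SimpleGraph.Walk.cons e.adj .nil)).append B2) := by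
      simp [← SimpleGraph.Walk.append_assoc]
    rw [key] at h hmin
    have := reroute w hle hf _ _ _ h hmin hde
    simp [newCount, hen] at this

theorem sub_pres (w : V → V → ℝ≥0∞) {G H : SimpleGraph V} (hle : H ≤ G)
    (hf : ∀ u v, G.Adj u v → w u v ≠ ⊤) (hw : ∀ u v, w u v = w v u)
    {s t : V} (q : G.Walk s t) (h : walkWeight w q = wdist G w s t)
    (hq : ∀ d ∈ q.darts, H.Adj d.fst d.snd) (y z : V) (hy : y ∈ q.support) (hz : z ∈ q.support) :
    wdist H w y z = wdist G w y z := by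
  have key : ∀ (y z : V) (A : G.Walk s y) (B : G.Walk y z) (C : G.Walk z t),
      q = A.append (B.append C) → wdist H w y z = wdist G w y z := by
    intro y z A B C hABC
    subst hABC
    have hB := mid_shortest w hf A B C h
    obtain ⟨B', hB'⟩ := exists_transfer w (H := H) B (fun d hd => hq d (by simp [hd]))
    exact le_antisymm (by rw [← hB, ← hB']; exact wdist_le_ww w _) (wdist_mono w hle _ _)
  have hs := SimpleGraph.Walk.take_spec q hy
  have hz' := hz
  rw [← hs, SimpleGraph.Walk.mem_support_append_iff] at hz'
  rcases hz' with h1 | h1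
  · rw [wdist_comm' w hw H, wdist_comm' w hw G]
    refine key z y ?_ ?_ ?_ ?_
    · exact (q.takeUntil y hy).takeUntil z h1
    · exact (q.takeUntil y hy).dropUntil z h1
    · exact q.dropUntil y hy
    · rw [SimpleGraph.Walk.append_assoc, SimpleGraph.Walk.take_spec, hs]
  · refine key y z ?_ ?_ ?_ ?_
    · exact q.takeUntil y hy
    · exact (q.dropUntil y hy).takeUntil z h1
    · exact (q.dropUntil y hy).dropUntil z h1
    · rw [SimpleGraph.Walk.take_spec, hs]

theorem exists_opt [Fintype V] (w : V → V → ℝ≥0∞) {G H : SimpleGraph V}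
    {s t : V} (hr : G.Reachable s t) : ∃ q : G.Walk s t, q.IsPath ∧
      walkWeight w q = wdist G w s t ∧
      ∀ q' : G.Walk s t, walkWeight w q' = wdist G w s t → newCount H q ≤ newCount H q' := by
  obtain ⟨q0, hq0⟩ := wdist_attained w hr
  obtain ⟨q, hq, hm⟩ := exists_minimal_newCount q0 hq0
  refine ⟨q.bypass, q.bypass_isPath, le_antisymm ((ww_bypass w q).trans hq.le) (wdist_le_ww w _),
    fun q' hq' => (nc_bypass H q).trans (hm q' hq')⟩
where
  exists_minimal_newCount (q0 : G.Walk s t) (hq0 : walkWeight w q0 = wdist G w s t) :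
    ∃ q : G.Walk s t, walkWeight w q = wdist G w s t ∧
      ∀ q' : G.Walk s t, walkWeight w q' = wdist G w s t → newCount H q ≤ newCount H q' := by
    have hne : {q : G.Walk s t | walkWeight w q = wdist G w s t}.Nonempty := ⟨q0, hq0⟩
    have wf := (measure (fun q : G.Walk s t => newCount H q)).wf
    refine ⟨wf.min _ hne, wf.min_mem _ hne, fun q' hq' => ?_⟩
    exact not_lt.1 (wf.not_lt_min _ hq')

theorem main_ind [Fintype V] (w : V → V → ℝ≥0∞) (G : SimpleGraph V)
    (hf : ∀ u v, G.Adj u v → w u v ≠ ⊤) (hw : ∀ u v, w u v = w v u) (hG : G.Connected)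
    (P : Finset (V × V)) :
    ∃ (H : SimpleGraph V) (S : V × V → Finset V), H ≤ G ∧
      (∀ p ∈ P, p.1 ∈ S p ∧ p.2 ∈ S p) ∧
      (∀ p ∈ P, ∀ y ∈ S p, ∀ z ∈ S p, wdist H w y z = wdist G w y z) ∧
      H.edgeSet.ncard ≤ (P.biUnion S).card + P.card ^ 2 := by
  induction P using Finset.induction_on with
  | empty => exact ⟨⊥, fun _ => ∅, bot_le, by simp, by simp, by simp⟩
  | insert a P ha ih =>
    obtain ⟨H, S, hle, h1, h2, h3⟩ := ih
    obtain ⟨q, hqp, hqw, hqm⟩ := exists_opt (H := H) w (hG a.1 a.2)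
    set N : Finset G.Dart := q.darts.toFinset.filter (fun d => ¬ H.Adj d.fst d.snd) with hN
    set H' : SimpleGraph V := H ⊔ SimpleGraph.fromEdgeSet {e | e ∈ q.edges} with hH'
    have hle' : H' ≤ G := by
      refine sup_le hle ?_
      intro x y hxy
      rw [SimpleGraph.fromEdgeSet_adj] at hxy
      exact q.adj_of_mem_edges hxy.1
    have hHH' : H ≤ H' := le_sup_left
    have hqd : ∀ d ∈ q.darts, H'.Adj d.fst d.snd := by
      intro d hd
      right
      rw [SimpleGraph.fromEdgeSet_adj]
      exact ⟨List.mem_map.2 ⟨d, hd, rfl⟩, d.adj.ne⟩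
    let S' : V × V → Finset V := Function.update S a q.support.toFinset
    have hSa : S' a = q.support.toFinset := by simp [S']
    have hSo : ∀ p ∈ P, S' p = S p := by
      intro p hp
      have : p ≠ a := by rintro rfl; exact ha hp
      simp [S', this]
    refine ⟨H', S', hle', ?_, ?_, ?_⟩
    · intro p hp
      rcases Finset.mem_insert.1 hp with rfl | hp
      · rw [hSa]; simp
      · rw [hSo p hp]; exact h1 p hp
    · intro p hp
      rcases Finset.mem_insert.1 hp with rfl | hp
      · rw [hSa]
        intro y hy z hz
        exact sub_pres w hle' hf hw q hqw hqd y z (by simpa using hy) (by simpa using hz)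
      · rw [hSo p hp]
        intro y hy z hz
        exact le_antisymm ((wdist_mono w hHH' y z).trans (h2 p hp y hy z hz).le)
          (wdist_mono w hle' y z)
    · have hU : P.biUnion S' = P.biUnion S := Finset.biUnion_congr rfl hSo
      have hE : H'.edgeSet.ncard ≤ H.edgeSet.ncard + N.card := by
        have hsub : H'.edgeSet ⊆ H.edgeSet ∪ ((N.image SimpleGraph.Dart.edge : Finset _) : Set _) := by
          intro e he
          by_cases heH : e ∈ H.edgeSet
          · exact Or.inl heH
          · right
            rw [hH', SimpleGraph.edgeSet_sup] at he
            rcases he with he | he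
            · exact (heH he).elim
            · rw [SimpleGraph.edgeSet_fromEdgeSet] at he
              obtain ⟨d, hd, rfl⟩ := List.mem_map.1 he.1
              simp only [Finset.coe_image, Set.mem_image]
              refine ⟨d, ?_, rfl⟩
              simp only [hN, Finset.coe_filter, Set.mem_setOf_eq, List.mem_toFinset]
              exact ⟨hd, heH⟩
        refine (Set.ncard_le_ncard hsub (Set.toFinite _)).trans ((Set.ncard_union_le _ _).trans ?_)
        rw [Set.ncard_coe_finset]
        exact Nat.add_le_add_left Finset.card_image_le _
      set U := P.biUnion S with hUdef
      have hN1 : (N.filter (fun d => d.snd ∉ U)).card ≤ (q.support.toFinset \ U).card := by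
        refine Finset.card_le_card_of_injOn (fun d => d.snd) ?_ ?_
        · intro d hd
          simp only [hN, Finset.coe_filter, Finset.mem_filter, List.mem_toFinset,
            Set.mem_setOf_eq] at hd
          simp only [Finset.coe_sdiff, Set.mem_diff, Finset.mem_coe, List.mem_toFinset]
          exact ⟨q.dart_snd_mem_support_of_mem_darts hd.1.1, hd.2⟩
        · intro d hd e he hde
          simp only [hN, Finset.coe_filter, Finset.mem_filter, List.mem_toFinset,
            Set.mem_setOf_eq] at hd he
          have hnd : (q.darts.map (fun d => d.snd)).Nodup := by
            have := q.map_snd_darts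
            rw [this]
            exact hqp.support_nodup.tail
          exact List.inj_on_of_nodup_map hnd hd.1.1 he.1.1 hde
      have hN2 : (N.filter (fun d => ¬ d.snd ∉ U)).card ≤ P.card := by
        have hex : ∀ d : G.Dart, d.snd ∈ U → ∃ p ∈ P, d.snd ∈ S p := by
          intro d hd; simpa [hUdef, and_assoc] using hd
        let f : G.Dart → V × V := fun d =>
          if h : d.snd ∈ U then (hex d h).choose else a
        have hfs : ∀ d : G.Dart, d.snd ∈ U → f d ∈ P ∧ d.snd ∈ S (f d) := by
          intro d hd
          simp only [f, dif_pos hd]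
          exact (hex d hd).choose_spec
        refine Finset.card_le_card_of_injOn f ?_ ?_
        · intro d hd
          simp only [Finset.coe_filter, Set.mem_setOf_eq, not_not] at hd
          exact (hfs d hd.2).1
        · intro d hd e he hde
          simp only [hN, Finset.coe_filter, Finset.mem_filter, List.mem_toFinset,
            Set.mem_setOf_eq, not_not] at hd he
          have hd' := hfs d hd.2
          have he' := hfs e he.2
          rw [← hde] at he'
          exact order_new w hle hf hw q hqw hqm d e hd.1.1 he.1.1 hd.1.2 he.1.2
            (h2 _ hd'.1 _ hd'.2 _ he'.2)
      have hN3 := Finset.card_filter_add_card_filter_not (s := N) (fun d => d.snd ∉ U)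
      have hcard : ((insert a P).biUnion S').card = U.card + (q.support.toFinset \ U).card := by
        rw [Finset.biUnion_insert, hU, hSa, Finset.union_comm, ← Finset.union_sdiff_self_eq_union,
          Finset.card_union_of_disjoint Finset.disjoint_sdiff]
      rw [hcard, Finset.card_insert_of_notMem ha]
      have : (P.card + 1) ^ 2 = P.card ^ 2 + 2 * P.card + 1 := by ring
      omega

theorem exists_linear_distance_preserver (c : ℝ) (hc : 0 ≤ c) :
    ∃ C : ℝ, ∀ (W : Type) (_ : Fintype W) (G : SimpleGraph W)
      (w : W → W → ℝ≥0∞), (∀ u v, w u v = w v u) →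
      (∀ u v, G.Adj u v → 0 < w u v) → (∀ u v, G.Adj u v → w u v ≠ ⊤) →
      G.Connected →
      ∀ P : Finset (W × W),
        (P.card : ℝ) ≤ c * (Fintype.card W : ℝ) ^ ((1 : ℝ) / 3) →
        ∃ G' : SimpleGraph W, G' ≤ G ∧
          (G'.edgeSet.ncard : ℝ) ≤ C * (Fintype.card W : ℝ) ∧
          ∀ p ∈ P, wdist G' w p.1 p.2 = wdist G w p.1 p.2 := by
  refine ⟨1 + c ^ 2, ?_⟩
  intro W _ G w hw _ hf hG P hP
  obtain ⟨H, S, hle, h1, h2, h3⟩ := main_ind w G hf hw hG P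
  refine ⟨H, hle, ?_, fun p hp => h2 p hp _ (h1 p hp).1 _ (h1 p hp).2⟩
  haveI := hG.nonempty
  have hn : (1 : ℝ) ≤ Fintype.card W := by exact_mod_cast Fintype.card_pos
  have hU : ((P.biUnion S).card : ℝ) ≤ Fintype.card W := by exact_mod_cast Finset.card_le_univ _
  have h3' : (H.edgeSet.ncard : ℝ) ≤ (P.biUnion S).card + (P.card : ℝ) ^ 2 := by exact_mod_cast h3
  have hroot : ((Fintype.card W : ℝ) ^ ((1 : ℝ) / 3)) ^ 2 ≤ Fintype.card W := by
    rw [← Real.rpow_natCast, ← Real.rpow_mul (by linarith)]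
    calc _ ≤ (Fintype.card W : ℝ) ^ (1 : ℝ) :=
          Real.rpow_le_rpow_of_exponent_le hn (by norm_num)
      _ = _ := Real.rpow_one _
  have hP2 : (P.card : ℝ) ^ 2 ≤ c ^ 2 * Fintype.card W := by
    calc (P.card : ℝ) ^ 2 ≤ (c * (Fintype.card W : ℝ) ^ ((1 : ℝ) / 3)) ^ 2 :=
          pow_le_pow_left₀ (by positivity) hP 2
      _ = c ^ 2 * ((Fintype.card W : ℝ) ^ ((1 : ℝ) / 3)) ^ 2 := by ring
      _ ≤ _ := by gcongr
  linarith
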